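/- Let x, m, n be nonnegative integers with m ≤ n and x + m ≥ 1. Then E(x,x+m;n) = (n!/⌊n/2⌋!) · [∏_{i=0}^{n−1} i! · (2x+m+i−1)! · (3x+m+2i+1)_i · (3x+2m+2i+1)_i / ((x+2i+1)! · (x+m+2i+1)!)] · (x+m)_{⌊n/2⌋−⌊m/2⌋} · ∑_{k=0}^{⌊m/2⌋} C(m, 2k+ε) · (⌊n/2⌋−k+1)_k · (x+⌈m/2⌉+⌊n/2⌋)_{⌊m/2⌋−k}, where ε = 1 if n is odd and ε = 0 if n is even. (Theorem 9) -/

import Mathlib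

open Finset

/-- The Pochhammer symbol `(a)_k = a(a+1)⋯(a+k-1)`. -/
noncomputable def poch (a : ℚ) (k : ℕ) : ℚ := ∏ i ∈ Finset.range k, (a + i)

/-- `rfac k = k!` for `k ≥ 0`, and `0` for negative `k`. -/
noncomputable def rfac (k : ℤ) : ℚ := if 0 ≤ k then (Nat.factorial k.toNat : ℚ) else 0

/-- `rfacInv k = 1/k!` for `k ≥ 0`, and `0` for negative `k`. -/
noncomputable def rfacInv (k : ℤ) : ℚ := if 0 ≤ k then (Nat.factorial k.toNat : ℚ)⁻¹ else 0

/-- The determinant `E(x,y;n)` with `(i,j)`-entry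
`(x+y+i+j−1)! (y−x+3j−3i) / ((x+2i−j+1)! (y+2j−i+1)!)`. -/
noncomputable def Edet (x y n : ℕ) : ℚ :=
  Matrix.det (Matrix.of fun i j : Fin n =>
    rfac ((x : ℤ) + (y : ℤ) + (i : ℕ) + (j : ℕ) - 1) *
      (((y : ℤ) - (x : ℤ) + 3 * ((j : ℕ) : ℤ) - 3 * ((i : ℕ) : ℤ)) : ℚ) *
      rfacInv ((x : ℤ) + 2 * (i : ℕ) - (j : ℕ) + 1) *
      rfacInv ((y : ℤ) + 2 * (j : ℕ) - (i : ℕ) + 1))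


/-- The rising factorial `a (a + 1) ⋯ (a + k - 1)` in a commutative ring. -/
def rising {R : Type*} [CommRing R] (a : R) (k : ℕ) : R := ∏ i ∈ Finset.range k, (a + i)

/-- The matrix obtained from that of `Edet` by extracting the factors
`(x + y + i - 1)! / ((x + 2i + 1)! (y + 2j + 1)!)` from its rows and columns. -/
def polyMatrix {R : Type*} [CommRing R] (x y : R) (n : ℕ) : Matrix (Fin n) (Fin n) R :=
  Matrix.of fun i j =>
    rising (x + y + (i : ℕ)) j * rising (x + 2 * (i : ℕ) - (j : ℕ) + 2) j *
      rising (y + 2 * (j : ℕ) - (i : ℕ) + 2) i * (y - x + 3 * (j : ℕ) - 3 * (i : ℕ))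

/-- `n!` times the coefficient of `z ^ n` in `(1 + z) ^ (-x) * (1 - z) ^ (-y)`. -/
def coeffPoly {R : Type*} [CommRing R] (x y : R) : ℕ → R
  | 0 => 1
  | 1 => y - x
  | n + 2 => (y - x) * coeffPoly x y (n + 1) + (n + 1) * (x + y + n) * coeffPoly x y n

/-- The factors of `(polyMatrix x y n).det` that are linear in `x` and `y`. -/
def linearFactors {R : Type*} [CommRing R] (x y : R) (n : ℕ) : R :=
  ∏ i ∈ Finset.range n, ((Nat.factorial i : R) * rising (2 * x + y + 2 * i + 1) i *
    rising (x + 2 * y + 2 * i + 1) i)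

section Desnanot

variable {R : Type*} [CommRing R] {n : ℕ}

lemma det_updateRow_zero_single (A : Matrix (Fin (n + 1)) (Fin (n + 1)) R) :
    (A.updateRow 0 (Pi.single 0 1)).det = (A.submatrix Fin.succ Fin.succ).det := by
  rw [← Matrix.adjugate_apply, Matrix.adjugate_fin_succ_eq_det_submatrix]
  simp only [Fin.succAbove_zero]
  simp

lemma det_updateRow_last_single (A : Matrix (Fin (n + 1)) (Fin (n + 1)) R) :
    (A.updateRow (Fin.last n) (Pi.single (Fin.last n) 1)).det =
      (A.submatrix Fin.castSucc Fin.castSucc).det := by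
  rw [← Matrix.adjugate_apply, Matrix.adjugate_fin_succ_eq_det_submatrix]
  simp only [Fin.succAbove_last]
  simp [← two_mul]

lemma det_updateRow_zero_last (A : Matrix (Fin (n + 2)) (Fin (n + 2)) R) :
    ((A.updateRow 0 (Pi.single 0 1)).updateRow (Fin.last (n + 1))
      (Pi.single (Fin.last (n + 1)) 1)).det =
      (A.submatrix (fun i : Fin n => i.castSucc.succ) (fun i : Fin n => i.castSucc.succ)).det := by
  rw [det_updateRow_last_single]
  have : (A.updateRow 0 (Pi.single 0 1)).submatrix Fin.castSucc Fin.castSucc =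
      (A.submatrix Fin.castSucc Fin.castSucc).updateRow 0 (Pi.single 0 1) := by
    ext i j
    refine Fin.cases ?_ (fun i => ?_) i
    · refine Fin.cases ?_ (fun j => ?_) j <;> simp
    · simp
  rw [this, det_updateRow_zero_single]
  rfl

lemma desnanot_jacobi_mul_det_sq (A : Matrix (Fin (n + 2)) (Fin (n + 2)) R) :
    A.det * ((A.submatrix Fin.succ Fin.succ).det * (A.submatrix Fin.castSucc Fin.castSucc).det -
        (A.submatrix Fin.succ Fin.castSucc).det * (A.submatrix Fin.castSucc Fin.succ).det) =
      A.det ^ 2 *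
        (A.submatrix (fun i : Fin n => i.castSucc.succ) (fun i : Fin n => i.castSucc.succ)).det := by
  set l := Fin.last (n + 1) with hl
  have h0l : (0 : Fin (n + 2)) ≠ l := (Fin.last_pos).ne
  let e : Fin 2 → Fin (n + 2) := ![0, l]
  let V : Matrix (Fin 2) (Fin (n + 2)) R := Matrix.of fun a => A.adjugate (e a) - Pi.single (e a) 1
  let U : Matrix (Fin (n + 2)) (Fin 2) R := Matrix.of fun i a =>
    (Pi.single (e a) 1 : Fin (n + 2) → R) i
  have hB : (1 + U * V) * A =
      (A.updateRow 0 (A.det • Pi.single 0 1)).updateRow l (A.det • Pi.single l 1) := by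
    have hVA : V * A = Matrix.of fun a j => A.det * (Pi.single (e a) 1 : Fin (n + 2) → R) j -
        A (e a) j := by
      ext a j
      have := congrFun (congrFun (Matrix.adjugate_mul A) (e a)) j
      rw [Matrix.mul_apply] at this ⊢
      simp only [V, Matrix.of_apply, Pi.sub_apply, sub_mul, Finset.sum_sub_distrib, this]
      simp [Matrix.one_apply, Pi.single_apply, eq_comm]
    rw [add_mul, one_mul, Matrix.mul_assoc, hVA]
    ext i j
    rw [Matrix.add_apply, Matrix.mul_apply, Fin.sum_univ_two]
    simp only [U, e, Matrix.of_apply, Matrix.cons_val_zero, Matrix.cons_val_one]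
    by_cases hi : i = l
    · subst hi
      simp [h0l.symm]
    · by_cases hi0 : i = 0
      · subst hi0
        simp [hi]
      · simp [hi, hi0]
  have hdet : (1 + U * V).det = (A.submatrix Fin.succ Fin.succ).det *
      (A.submatrix Fin.castSucc Fin.castSucc).det -
        (A.submatrix Fin.succ Fin.castSucc).det * (A.submatrix Fin.castSucc Fin.succ).det := by
    rw [Matrix.det_one_add_mul_comm, Matrix.det_fin_two]
    have hVU : ∀ a b, (1 + V * U : Matrix (Fin 2) (Fin 2) R) a b = A.adjugate (e a) (e b) := by
      intro a b
      rw [Matrix.add_apply, Matrix.mul_apply]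
      simp only [V, U, Matrix.of_apply, Pi.single_apply, mul_ite, mul_one, mul_zero,
        Finset.sum_ite_eq', Finset.mem_univ, if_true, Pi.sub_apply]
      fin_cases a <;> fin_cases b <;> simp [e, h0l, h0l.symm]
    simp only [hVU, Matrix.adjugate_fin_succ_eq_det_submatrix, e, Matrix.cons_val_zero,
      Matrix.cons_val_one, hl, Fin.succAbove_last, Fin.succAbove_zero]
    have hs : ((-1 : R) ^ (n + 1)) * (-1) ^ (n + 1) = 1 := by
      rw [← mul_pow]; simp
    simp only [Fin.val_zero, Fin.val_last, zero_add, add_zero, pow_add, pow_zero]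
    linear_combination ((A.submatrix Fin.succ Fin.succ).det *
      (A.submatrix Fin.castSucc Fin.castSucc).det - (A.submatrix Fin.succ Fin.castSucc).det *
      (A.submatrix Fin.castSucc Fin.succ).det) * hs
  have := congrArg Matrix.det hB
  rw [Matrix.det_mul, hdet, Matrix.det_updateRow_smul, Matrix.updateRow_comm _ h0l,
    Matrix.det_updateRow_smul, Matrix.updateRow_comm _ h0l.symm, det_updateRow_zero_last] at this
  linear_combination this

/-- The Desnanot–Jacobi identity (Dodgson condensation). -/
theorem desnanot_jacobi (A : Matrix (Fin (n + 2)) (Fin (n + 2)) R) :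
    A.det *
        (A.submatrix (fun i : Fin n => i.castSucc.succ) (fun i : Fin n => i.castSucc.succ)).det =
      (A.submatrix Fin.succ Fin.succ).det * (A.submatrix Fin.castSucc Fin.castSucc).det -
        (A.submatrix Fin.succ Fin.castSucc).det * (A.submatrix Fin.castSucc Fin.succ).det := by
  let X := Matrix.mvPolynomialX (Fin (n + 2)) (Fin (n + 2)) ℤ
  have hX : X.det *
      (X.submatrix (fun i : Fin n => i.castSucc.succ) (fun i : Fin n => i.castSucc.succ)).det =
      (X.submatrix Fin.succ Fin.succ).det * (X.submatrix Fin.castSucc Fin.castSucc).det -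
        (X.submatrix Fin.succ Fin.castSucc).det * (X.submatrix Fin.castSucc Fin.succ).det := by
    apply mul_left_cancel₀ (Matrix.det_mvPolynomialX_ne_zero (Fin (n + 2)) ℤ)
    rw [desnanot_jacobi_mul_det_sq X]
    ring
  let f : MvPolynomial (Fin (n + 2) × Fin (n + 2)) ℤ →+* R :=
    MvPolynomial.eval₂Hom (Int.castRingHom R) fun p => A p.1 p.2
  have hA : A = f.mapMatrix X := by
    ext i j
    simp [f, X]
  have := congrArg f hX
  simp only [map_mul, map_sub, RingHom.map_det, RingHom.mapMatrix_apply,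
    ← Matrix.submatrix_map] at this
  rw [hA]
  exact this

end Desnanot

section Rising

variable {R : Type*} [CommRing R]

lemma rising_zero (a : R) : rising a 0 = 1 := by simp [rising]

lemma rising_succ (a : R) (k : ℕ) : rising a (k + 1) = rising a k * (a + k) := by
  simp [rising, Finset.prod_range_succ]

lemma rising_succ' (a : R) (k : ℕ) : rising a (k + 1) = a * rising (a + 1) k := by
  rw [rising, Finset.prod_range_succ', mul_comm, rising]
  congr 1
  · simp
  · exact Finset.prod_congr rfl fun i _ => by push_cast; ring

lemma rising_add (a : R) (k l : ℕ) : rising a (k + l) = rising a k * rising (a + k) l := by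
  rw [rising, Finset.prod_range_add]
  congr 1
  exact Finset.prod_congr rfl fun i _ => by push_cast; ring

lemma map_rising {S : Type*} [CommRing S] (f : R →+* S) (a : R) (k : ℕ) :
    f (rising a k) = rising (f a) k := by
  simp [rising, map_prod]

lemma rising_pos {a : ℚ} (ha : 0 < a) (k : ℕ) : 0 < rising a k :=
  Finset.prod_pos fun i _ => by positivity

end Rising

section Minors

variable {R : Type*} [CommRing R] (x y : R) (n : ℕ)

lemma det_polyMatrix_castSucc_castSucc :
    ((polyMatrix x y (n + 1)).submatrix Fin.castSucc Fin.castSucc).det =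
      (polyMatrix x y n).det := by
  congr 1

lemma polyMatrix_succ_succ (i j : Fin n) :
    polyMatrix x y (n + 1) i.succ j.succ =
      ((x + y + (i : ℕ) + 1) * (x + 2 * (i : ℕ) + 3)) *
        ((y + 2 * (j : ℕ) + 3) * polyMatrix (x + 1) (y + 1) n i j) := by
  simp only [polyMatrix, Matrix.of_apply, Fin.val_succ]
  rw [rising_succ', rising_succ _ (j : ℕ), rising_succ _ (i : ℕ)]
  push_cast
  rw [show x + y + ((i : ℕ) + 1 : R) + 1 = x + 1 + (y + 1) + (i : ℕ) by ring,
    show x + 2 * ((i : ℕ) + 1 : R) - ((j : ℕ) + 1) + 2 = x + 1 + 2 * (i : ℕ) - (j : ℕ) + 2 by ring,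
    show y + 2 * ((j : ℕ) + 1 : R) - ((i : ℕ) + 1) + 2 = y + 1 + 2 * (j : ℕ) - (i : ℕ) + 2 by ring]
  ring

lemma polyMatrix_castSucc_succ (i j : Fin n) :
    polyMatrix x y (n + 1) i.castSucc j.succ =
      ((x + y + (i : ℕ)) * (x + 2 * (i : ℕ) + 1)) * polyMatrix (x - 1) (y + 2) n i j := by
  simp only [polyMatrix, Matrix.of_apply, Fin.val_succ, Fin.val_castSucc]
  rw [rising_succ', rising_succ _ (j : ℕ)]
  push_cast
  rw [show x + y + ((i : ℕ) : R) + 1 = x - 1 + (y + 2) + (i : ℕ) by ring,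
    show x + 2 * ((i : ℕ) : R) - ((j : ℕ) + 1) + 2 = x - 1 + 2 * (i : ℕ) - (j : ℕ) + 2 by ring,
    show y + 2 * ((j : ℕ) + 1 : R) - (i : ℕ) + 2 = y + 2 + 2 * (j : ℕ) - (i : ℕ) + 2 by ring]
  ring

lemma polyMatrix_succ_castSucc (i j : Fin n) :
    polyMatrix x y (n + 1) i.succ j.castSucc =
      (y + 2 * (j : ℕ) + 1) * polyMatrix (x + 2) (y - 1) n i j := by
  simp only [polyMatrix, Matrix.of_apply, Fin.val_succ, Fin.val_castSucc]
  rw [rising_succ _ (i : ℕ)]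
  push_cast
  rw [show x + y + ((i : ℕ) + 1 : R) = x + 2 + (y - 1) + (i : ℕ) by ring,
    show x + 2 * ((i : ℕ) + 1 : R) - (j : ℕ) + 2 = x + 2 + 2 * (i : ℕ) - (j : ℕ) + 2 by ring,
    show y + 2 * ((j : ℕ) : R) - ((i : ℕ) + 1) + 2 = y - 1 + 2 * (j : ℕ) - (i : ℕ) + 2 by ring]
  ring

lemma det_scale {r c : Fin n → R} {A B : Matrix (Fin n) (Fin n) R}
    (h : ∀ i j, A i j = r i * (c j * B i j)) :
    A.det = (∏ i, r i) * (∏ i, c i) * B.det := by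
  rw [mul_assoc, ← Matrix.det_mul_row c B, ← Matrix.det_mul_column r]
  congr 1
  ext i j
  exact h i j

lemma det_polyMatrix_succ_succ :
    ((polyMatrix x y (n + 1)).submatrix Fin.succ Fin.succ).det =
      (∏ i ∈ Finset.range n, ((x + y + i + 1) * (x + 2 * i + 3) * (y + 2 * i + 3))) *
        (polyMatrix (x + 1) (y + 1) n).det := by
  rw [det_scale n (A := (polyMatrix x y (n + 1)).submatrix Fin.succ Fin.succ)
    (polyMatrix_succ_succ x y n), ← Finset.prod_mul_distrib, Finset.prod_range]

lemma det_polyMatrix_castSucc_succ :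
    ((polyMatrix x y (n + 1)).submatrix Fin.castSucc Fin.succ).det =
      (∏ i ∈ Finset.range n, ((x + y + i) * (x + 2 * i + 1))) *
        (polyMatrix (x - 1) (y + 2) n).det := by
  rw [det_scale n (r := fun i => (x + y + (i : ℕ)) * (x + 2 * (i : ℕ) + 1)) (c := fun _ => 1)
    (B := polyMatrix (x - 1) (y + 2) n)
    (fun i j => by rw [one_mul]; exact polyMatrix_castSucc_succ x y n i j), Finset.prod_range]
  simp

lemma det_polyMatrix_succ_castSucc :
    ((polyMatrix x y (n + 1)).submatrix Fin.succ Fin.castSucc).det =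
      (∏ i ∈ Finset.range n, (y + 2 * i + 1)) * (polyMatrix (x + 2) (y - 1) n).det := by
  rw [det_scale n (r := fun _ => 1) (c := fun j => y + 2 * (j : ℕ) + 1)
    (B := polyMatrix (x + 2) (y - 1) n)
    (fun i j => by rw [one_mul]; exact polyMatrix_succ_castSucc x y n i j), Finset.prod_range]
  simp

lemma det_polyMatrix_interior :
    ((polyMatrix x y (n + 2)).submatrix (fun i : Fin n => i.castSucc.succ)
      (fun i : Fin n => i.castSucc.succ)).det =
      (∏ i ∈ Finset.range n, ((x + y + i + 1) * (x + 2 * i + 3) * (y + 2 * i + 3))) *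
        (polyMatrix (x + 1) (y + 1) n).det := by
  rw [← det_polyMatrix_succ_succ]
  congr 1

/-- Condensation of `(polyMatrix x y (n + 2)).det`, before cancelling common factors. -/
lemma det_polyMatrix_condensation :
    (∏ i ∈ Finset.range n, ((x + y + i + 1) * (x + 2 * i + 3) * (y + 2 * i + 3))) *
        ((polyMatrix x y (n + 2)).det * (polyMatrix (x + 1) (y + 1) n).det) =
      (∏ i ∈ Finset.range n, ((x + y + i + 1) * (x + 2 * i + 3) * (y + 2 * i + 3))) *
        ((x + y + n + 1) * (x + 2 * n + 3) * (y + 2 * n + 3) *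
            (polyMatrix x y (n + 1)).det * (polyMatrix (x + 1) (y + 1) (n + 1)).det -
          (x + y) * (x + 1) * (y + 1) *
            (polyMatrix (x - 1) (y + 2) (n + 1)).det *
            (polyMatrix (x + 2) (y - 1) (n + 1)).det) := by
  have h := desnanot_jacobi (polyMatrix x y (n + 2))
  rw [det_polyMatrix_interior, det_polyMatrix_succ_succ, det_polyMatrix_castSucc_castSucc,
    det_polyMatrix_succ_castSucc, det_polyMatrix_castSucc_succ, Finset.prod_range_succ] at h
  have hshift : (∏ i ∈ Finset.range (n + 1), ((x + y + i) * (x + 2 * i + 1))) *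
      (∏ i ∈ Finset.range (n + 1), (y + 2 * i + 1)) =
      (x + y) * (x + 1) * (y + 1) *
        ∏ i ∈ Finset.range n, ((x + y + i + 1) * (x + 2 * i + 3) * (y + 2 * i + 3)) := by
    rw [← Finset.prod_mul_distrib, Finset.prod_range_succ', mul_comm]
    congr 1
    · push_cast; ring
    · exact Finset.prod_congr rfl fun i _ => by push_cast; ring
  linear_combination h - (polyMatrix (x - 1) (y + 2) (n + 1)).det *
            (polyMatrix (x + 2) (y - 1) (n + 1)).det * hshift

end Minors

section CoeffPoly

variable {R : Type*} [CommRing R] (x y : R)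

lemma coeffPoly_add_two (n : ℕ) : coeffPoly x y (n + 2) =
    (y - x) * coeffPoly x y (n + 1) + (n + 1) * (x + y + n) * coeffPoly x y n := by
  rw [coeffPoly]

lemma coeffPoly_sub_one (n : ℕ) : coeffPoly (x - 1) y (n + 1) =
    coeffPoly x y (n + 1) + (n + 1) * coeffPoly x y n := by
  induction n using Nat.twoStepInduction with
  | zero => simp [coeffPoly]; ring
  | one => simp [coeffPoly]; ring
  | more n h0 h1 =>
    rw [coeffPoly_add_two, h1, h0]
    simp only [coeffPoly_add_two]
    push_cast
    ring

lemma coeffPoly_swap (n : ℕ) : coeffPoly y x n = (-1) ^ n * coeffPoly x y n := by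
  induction n using Nat.twoStepInduction with
  | zero => simp [coeffPoly]
  | one => simp [coeffPoly]
  | more n h0 h1 =>
    rw [coeffPoly_add_two, coeffPoly_add_two, h1, h0]
    ring

lemma coeffPoly_eq_add_one_add_one (n : ℕ) : coeffPoly x y (n + 2) =
    (y - x) * coeffPoly (x + 1) (y + 1) (n + 1) +
      (n + 1) * (x + y) * coeffPoly (x + 1) (y + 1) n := by
  induction n using Nat.twoStepInduction with
  | zero => simp [coeffPoly]
  | one => simp [coeffPoly]; ring
  | more n h0 h1 =>
    rw [coeffPoly_add_two, h1, h0]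
    simp only [coeffPoly_add_two]
    push_cast
    ring

lemma mul_coeffPoly_eq_add_one_add_one (n : ℕ) : (x + y + n + 1) * coeffPoly x y (n + 1) =
    (x + y) * coeffPoly (x + 1) (y + 1) (n + 1) +
      (n + 1) * (y - x) * coeffPoly (x + 1) (y + 1) n := by
  cases n with
  | zero => simp [coeffPoly]; ring
  | succ n =>
    rw [coeffPoly_eq_add_one_add_one]
    simp only [coeffPoly_add_two]
    push_cast
    ring

lemma mul_coeffPoly_sub_one_add_two (n : ℕ) :
    (y + 1) * coeffPoly (x - 1) (y + 2) (n + 1) =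
      (y + 2 * n + 3) * coeffPoly (x + 1) (y + 1) (n + 1) +
        (n + 1) * (2 * x + y + 2 * n + 3) * coeffPoly (x + 1) (y + 1) n := by
  induction n using Nat.twoStepInduction with
  | zero => simp [coeffPoly]; ring
  | one => simp [coeffPoly]; ring
  | more n h0 h1 =>
    rw [coeffPoly_add_two, mul_add, mul_left_comm, h1, mul_left_comm (y + 1), h0]
    simp only [coeffPoly_add_two]
    push_cast
    ring

lemma mul_coeffPoly_add_two_sub_one (n : ℕ) :
    (x + 1) * coeffPoly (x + 2) (y - 1) (n + 1) =
      (x + 2 * n + 3) * coeffPoly (x + 1) (y + 1) (n + 1) -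
        (n + 1) * (x + 2 * y + 2 * n + 3) * coeffPoly (x + 1) (y + 1) n := by
  have h := mul_coeffPoly_sub_one_add_two y x n
  rw [coeffPoly_swap (x + 2), coeffPoly_swap (x + 1), coeffPoly_swap (x + 1)] at h
  have hs : ((-1 : R) ^ n) * (-1) ^ n = 1 := by
    rw [← mul_pow]; simp
  linear_combination (-(-1) ^ n) * h + (-(x + 1) * coeffPoly (x + 2) (y - 1) (n + 1) +
      (x + 2 * n + 3) * coeffPoly (x + 1) (y + 1) (n + 1) -
        (n + 1) * (x + 2 * y + 2 * n + 3) * coeffPoly (x + 1) (y + 1) n) * hs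

lemma coeffPoly_condensation (n : ℕ) :
    (n + 1) * (2 * x + y + 2 * n + 3) * (x + 2 * y + 2 * n + 3) *
        (coeffPoly x y (n + 2) * coeffPoly (x + 1) (y + 1) n) =
      (x + y + n + 1) * (x + 2 * n + 3) * (y + 2 * n + 3) *
          coeffPoly x y (n + 1) * coeffPoly (x + 1) (y + 1) (n + 1) -
        (x + y) * (x + 1) * (y + 1) *
          coeffPoly (x - 1) (y + 2) (n + 1) * coeffPoly (x + 2) (y - 1) (n + 1) := by
  have h1 := mul_coeffPoly_eq_add_one_add_one x y n
  have h2 := mul_coeffPoly_sub_one_add_two x y n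
  have h3 := mul_coeffPoly_add_two_sub_one x y n
  rw [coeffPoly_eq_add_one_add_one]
  linear_combination (-(x + 2 * n + 3) * (y + 2 * n + 3) *
      coeffPoly (x + 1) (y + 1) (n + 1)) * h1 +
    (x + y) * ((x + 1) * coeffPoly (x + 2) (y - 1) (n + 1)) * h2 +
    (x + y) * ((y + 2 * n + 3) * coeffPoly (x + 1) (y + 1) (n + 1) +
        (n + 1) * (2 * x + y + 2 * n + 3) * coeffPoly (x + 1) (y + 1) n) * h3

lemma map_coeffPoly {S : Type*} [CommRing S] (f : R →+* S) (n : ℕ) :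
    f (coeffPoly x y n) = coeffPoly (f x) (f y) n := by
  induction n using Nat.twoStepInduction with
  | zero => simp [coeffPoly]
  | one => simp [coeffPoly]
  | more n h0 h1 => simp [coeffPoly, h0, h1]

lemma coeffPoly_pos {x y : ℚ} (hx : 0 < x) (hxy : x < y) (n : ℕ) : 0 < coeffPoly x y n := by
  induction n using Nat.twoStepInduction with
  | zero => simp [coeffPoly]
  | one => simpa [coeffPoly] using hxy
  | more n h0 h1 =>
    rw [coeffPoly_add_two]
    have := sub_pos.2 hxy
    have := hx.trans hxy
    positivity

end CoeffPoly

section Evaluation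

lemma linearFactors_pos {x y : ℚ} (hx : 0 < x) (hy : 0 < y) (n : ℕ) : 0 < linearFactors x y n :=
  Finset.prod_pos fun i _ => by
    have := rising_pos (a := 2 * x + y + 2 * i + 1) (by positivity) i
    have := rising_pos (a := x + 2 * y + 2 * i + 1) (by positivity) i
    positivity

/-- The contribution of one linear form to `linearFactors`. -/
def risingProduct {R : Type*} [CommRing R] (u : R) (n : ℕ) : R :=
  ∏ i ∈ Finset.range n, rising (u + 2 * i + 1) i

lemma linearFactors_eq {R : Type*} [CommRing R] (x y : R) (n : ℕ) :
    linearFactors x y n = (∏ i ∈ Finset.range n, (Nat.factorial i : R)) *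
      risingProduct (2 * x + y) n * risingProduct (x + 2 * y) n := by
  simp only [linearFactors, risingProduct, Finset.prod_mul_distrib]

lemma risingProduct_condensation {R : Type*} [CommRing R] (u : R) (n : ℕ) :
    risingProduct u (n + 2) * risingProduct (u + 3) n =
      (u + 2 * n + 3) * (risingProduct u (n + 1) * risingProduct (u + 3) (n + 1)) := by
  simp only [risingProduct, Finset.prod_range_succ]
  push_cast
  rw [rising_succ', show u + 2 * ((n : R) + 1) + 1 + 1 = u + 3 + 2 * n + 1 by ring]
  ring

lemma linearFactors_condensation {R : Type*} [CommRing R] (x y : R) (n : ℕ) :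
    linearFactors x y (n + 2) * linearFactors (x + 1) (y + 1) n =
      (n + 1) * (2 * x + y + 2 * n + 3) * (x + 2 * y + 2 * n + 3) *
        (linearFactors x y (n + 1) * linearFactors (x + 1) (y + 1) (n + 1)) := by
  simp only [linearFactors_eq]
  rw [show 2 * (x + 1) + (y + 1) = 2 * x + y + 3 by ring,
    show x + 1 + 2 * (y + 1) = x + 2 * y + 3 by ring]
  have h1 := risingProduct_condensation (2 * x + y) n
  have h2 := risingProduct_condensation (x + 2 * y) n
  simp only [Finset.prod_range_succ, Nat.factorial_succ]
  push_cast
  set F := ∏ i ∈ Finset.range n, (Nat.factorial i : R)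
  linear_combination (F ^ 2 * (n.factorial : R) ^ 2 * (n + 1)) *
    (risingProduct (x + 2 * y) (n + 2) * risingProduct (x + 2 * y + 3) n * h1 +
      (2 * x + y + 2 * n + 3) * (risingProduct (2 * x + y) (n + 1) *
        risingProduct (2 * x + y + 3) (n + 1)) * h2)

lemma linearFactors_antidiagonal {R : Type*} [CommRing R] (x y : R) (n : ℕ) :
    linearFactors (x - 1) (y + 2) n * linearFactors (x + 2) (y - 1) n =
      linearFactors x y n * linearFactors (x + 1) (y + 1) n := by
  simp only [linearFactors_eq]
  rw [show 2 * (x + 1) + (y + 1) = 2 * x + y + 3 by ring,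
    show x + 1 + 2 * (y + 1) = x + 2 * y + 3 by ring,
    show 2 * (x - 1) + (y + 2) = 2 * x + y by ring,
    show x - 1 + 2 * (y + 2) = x + 2 * y + 3 by ring,
    show 2 * (x + 2) + (y - 1) = 2 * x + y + 3 by ring,
    show x + 2 + 2 * (y - 1) = x + 2 * y by ring]
  ring

lemma det_polyMatrix_of_large (n : ℕ) : ∀ x y : ℚ, (n : ℚ) < x → x + 3 * n < y →
    (polyMatrix x y n).det = linearFactors x y n * coeffPoly x y n := by
  induction n using Nat.twoStepInduction with
  | zero => simp [coeffPoly, linearFactors]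
  | one =>
    intro x y _ _
    simp [polyMatrix, coeffPoly, linearFactors, rising]
  | more n h0 h1 =>
    intro x y hx hy
    push_cast at hx hy h1
    have hn : (0 : ℚ) ≤ n := n.cast_nonneg
    have hx0 : 0 < x := by linarith
    have hy0 : 0 < y := by linarith
    have hD := mul_left_cancel₀ (Finset.prod_pos fun i _ => by positivity).ne'
      (det_polyMatrix_condensation x y n)
    rw [h0 (x + 1) (y + 1) (by linarith) (by linarith), h1 x y (by linarith) (by linarith),
      h1 (x + 1) (y + 1) (by linarith) (by linarith),
      h1 (x - 1) (y + 2) (by linarith) (by linarith),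
      h1 (x + 2) (y - 1) (by linarith) (by linarith)] at hD
    have hpos : 0 < linearFactors (x + 1) (y + 1) n * coeffPoly (x + 1) (y + 1) n :=
      mul_pos (linearFactors_pos (by linarith) (by linarith) n)
        (coeffPoly_pos (by linarith) (by linarith) n)
    apply mul_right_cancel₀ hpos.ne'
    have hL := linearFactors_condensation x y n
    have hA := linearFactors_antidiagonal x y (n + 1)
    have hC := coeffPoly_condensation x y n
    linear_combination hD - coeffPoly x y (n + 2) * coeffPoly (x + 1) (y + 1) n * hL -
      (linearFactors x y (n + 1) * linearFactors (x + 1) (y + 1) (n + 1)) * hC -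
      (x + y) * (x + 1) * (y + 1) * coeffPoly (x - 1) (y + 2) (n + 1) *
        coeffPoly (x + 2) (y - 1) (n + 1) * hA

lemma map_linearFactors {R S : Type*} [CommRing R] [CommRing S] (f : R →+* S) (x y : R) (n : ℕ) :
    f (linearFactors x y n) = linearFactors (f x) (f y) n := by
  simp [linearFactors, map_prod, map_rising, map_ofNat f]

lemma map_det_polyMatrix {R S : Type*} [CommRing R] [CommRing S] (f : R →+* S) (x y : R)
    (n : ℕ) : f (polyMatrix x y n).det = (polyMatrix (f x) (f y) n).det := by
  rw [RingHom.map_det]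
  congr 1
  ext i j
  simp [polyMatrix, map_rising, map_ofNat f]

theorem det_polyMatrix (x y : ℚ) (n : ℕ) :
    (polyMatrix x y n).det = linearFactors x y n * coeffPoly x y n := by
  let X : Polynomial ℚ := Polynomial.C x + Polynomial.X
  let Y : Polynomial ℚ := Polynomial.C y + 2 * Polynomial.X
  have key : (polyMatrix X Y n).det = linearFactors X Y n * coeffPoly X Y n := by
    apply Polynomial.eq_of_infinite_eval_eq
    apply (Set.Ioi_infinite (max (n - x) (x + 3 * n - y))).mono
    intro t ht
    obtain ⟨h1, h2⟩ := max_lt_iff.1 (Set.mem_Ioi.1 ht)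
    have hX : Polynomial.evalRingHom t X = x + t := by simp [X]
    have hY : Polynomial.evalRingHom t Y = y + 2 * t := by simp [Y]
    change Polynomial.evalRingHom t _ = Polynomial.evalRingHom t _
    rw [map_mul, map_det_polyMatrix, map_linearFactors, map_coeffPoly, hX, hY]
    exact det_polyMatrix_of_large n _ _ (by linarith) (by linarith)
  have := congrArg (Polynomial.evalRingHom 0) key
  rw [map_mul, map_det_polyMatrix, map_linearFactors, map_coeffPoly] at this
  simpa [X, Y] using this

end Evaluation

section Specialization

lemma cast_factorial_add (a j : ℕ) :
    ((a + j).factorial : ℚ) = a.factorial * rising (a + 1 : ℚ) j := by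
  induction j with
  | zero => simp [rising_zero]
  | succ j ih =>
    rw [← add_assoc, Nat.factorial_succ, rising_succ]
    push_cast
    rw [ih]
    ring

lemma rfacInv_sub (a j : ℕ) :
    rfacInv ((a : ℤ) - j) = (a.factorial : ℚ)⁻¹ * rising ((a : ℚ) - j + 1) j := by
  rcases le_or_gt j a with h | h
  · obtain ⟨b, rfl⟩ := Nat.exists_eq_add_of_le' h
    have hb := Nat.cast_ne_zero (R := ℚ) |>.2 (b + j).factorial_ne_zero
    have hb' := Nat.cast_ne_zero (R := ℚ) |>.2 b.factorial_ne_zero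
    rw [show ((b + j : ℕ) : ℤ) - j = (b : ℤ) by push_cast; ring, rfacInv, if_pos (by positivity),
      Int.toNat_natCast]
    rw [show ((b + j : ℕ) : ℚ) - j + 1 = b + 1 by push_cast; ring]
    field_simp
    rw [cast_factorial_add]
  · rw [rfacInv, if_neg (by omega)]
    symm
    apply mul_eq_zero_of_right
    apply Finset.prod_eq_zero (i := j - a - 1) (Finset.mem_range.2 (by omega))
    have : ((j - a - 1 : ℕ) : ℚ) = j - a - 1 := by
      rw [Nat.cast_sub (by omega), Nat.cast_sub (by omega)]
      simp
    rw [this]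
    ring

lemma Edet_eq_det_polyMatrix (x y n : ℕ) (h : 1 ≤ x + y) :
    Edet x y n = (∏ i ∈ Finset.range n, (((x + y + i - 1).factorial : ℚ) /
      ((x + 2 * i + 1).factorial * (y + 2 * i + 1).factorial))) *
        (polyMatrix (x : ℚ) (y : ℚ) n).det := by
  rw [Edet, det_scale n
    (r := fun i => ((x + y + (i : ℕ) - 1).factorial : ℚ) * ((x + 2 * (i : ℕ) + 1).factorial : ℚ)⁻¹)
    (c := fun j => ((y + 2 * (j : ℕ) + 1).factorial : ℚ)⁻¹) (B := polyMatrix (x : ℚ) (y : ℚ) n),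
    ← Finset.prod_mul_distrib, Finset.prod_range]
  · congr 1
    refine Finset.prod_congr rfl fun i _ => ?_
    rw [div_eq_mul_inv, mul_inv, mul_assoc]
  · intro i j
    have h1 : rfac ((x : ℤ) + (y : ℤ) + (i : ℕ) + (j : ℕ) - 1) =
        (x + y + (i : ℕ) - 1).factorial * rising ((x : ℚ) + y + (i : ℕ)) (j : ℕ) := by
      obtain ⟨a, ha⟩ : ∃ a, x + y + (i : ℕ) = a + 1 := ⟨x + y + i - 1, by omega⟩
      rw [ha, show (x : ℚ) + y + (i : ℕ) = a + 1 by exact_mod_cast ha, Nat.add_sub_cancel,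
        ← cast_factorial_add, rfac, if_pos (by omega)]
      congr 2
      omega
    have h2 : rfacInv ((x : ℤ) + 2 * (i : ℕ) - (j : ℕ) + 1) =
        ((x + 2 * (i : ℕ) + 1).factorial : ℚ)⁻¹ *
          rising ((x : ℚ) + 2 * (i : ℕ) - (j : ℕ) + 2) (j : ℕ) := by
      convert rfacInv_sub (x + 2 * i + 1) j using 2
      · push_cast; ring
      · congr 1; push_cast; ring
    have h3 : rfacInv ((y : ℤ) + 2 * (j : ℕ) - (i : ℕ) + 1) =
        ((y + 2 * (j : ℕ) + 1).factorial : ℚ)⁻¹ *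
          rising ((y : ℚ) + 2 * (j : ℕ) - (i : ℕ) + 2) (i : ℕ) := by
      convert rfacInv_sub (y + 2 * j + 1) i using 2
      · push_cast; ring
      · congr 1; push_cast; ring
    simp only [Matrix.of_apply, polyMatrix]
    rw [h1, h2, h3]
    push_cast
    ring

lemma coeffPoly_self (y : ℚ) (h : ℕ) :
    coeffPoly y y (2 * h) = (2 * h).factorial * (rising y h / h.factorial) ∧
      coeffPoly y y (2 * h + 1) = 0 := by
  induction h with
  | zero => simp [coeffPoly, rising_zero]
  | succ h ih =>
    have h0 := Nat.cast_ne_zero (R := ℚ) |>.2 h.factorial_ne_zero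
    have he : coeffPoly y y (2 * (h + 1)) =
        (2 * (h + 1)).factorial * (rising y (h + 1) / (h + 1).factorial) := by
      rw [show 2 * (h + 1) = 2 * h + 2 by ring, coeffPoly_add_two, ih.1, rising_succ]
      simp only [Nat.factorial_succ]
      push_cast
      field_simp
      ring
    refine ⟨he, ?_⟩
    rw [show 2 * (h + 1) + 1 = 2 * h + 1 + 2 by ring, coeffPoly_add_two, ih.2]
    simp

lemma coeffPoly_sub_natCast (y : ℚ) (m : ℕ) : ∀ h : ℕ,
    coeffPoly (y - m) y (2 * h) = (2 * h).factorial *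
        ∑ k ∈ Finset.range (h + 1), (m.choose (2 * k) : ℚ) *
          (rising y (h - k) / (h - k).factorial) ∧
      coeffPoly (y - m) y (2 * h + 1) = (2 * h + 1).factorial *
        ∑ k ∈ Finset.range (h + 1), (m.choose (2 * k + 1) : ℚ) *
          (rising y (h - k) / (h - k).factorial) := by
  induction m with
  | zero =>
    intro h
    obtain ⟨h0, h1⟩ := coeffPoly_self y h
    rw [Finset.sum_range_succ']
    simp [h0, h1, Nat.choose_eq_zero_of_lt, mul_add]
  | succ m ih =>
    intro h
    have hx : y - ((m + 1 : ℕ) : ℚ) = y - m - 1 := by push_cast; ring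
    rw [hx]
    constructor
    · cases h with
      | zero => simp [coeffPoly, rising_zero]
      | succ h =>
        rw [show 2 * (h + 1) = 2 * h + 1 + 1 by ring, coeffPoly_sub_one, (ih h).2,
          show 2 * h + 1 + 1 = 2 * (h + 1) by ring, (ih (h + 1)).1,
          Finset.sum_range_succ' _ (h + 1), Finset.sum_range_succ' _ (h + 1)]
        simp only [show ∀ k, 2 * (k + 1) = 2 * k + 1 + 1 from fun k => by ring,
          Nat.choose_succ_succ, Nat.add_sub_add_right, Nat.cast_add, add_mul,
          Finset.sum_add_distrib, Nat.factorial_succ (2 * h + 1)]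
        push_cast
        simp only [Nat.choose_zero_right]
        ring
    · rw [coeffPoly_sub_one, (ih h).1, (ih h).2]
      simp only [Nat.choose_succ_succ, Nat.cast_add, add_mul, Finset.sum_add_distrib,
        Nat.factorial_succ (2 * h)]
      push_cast
      ring

lemma coeffPoly_natCast_add (x m n : ℕ) :
    coeffPoly (x : ℚ) ((x : ℚ) + m) n = n.factorial *
      ∑ k ∈ Finset.range (n / 2 + 1), (m.choose (2 * k + if Odd n then 1 else 0) : ℚ) *
        (rising ((x : ℚ) + m) (n / 2 - k) / (n / 2 - k).factorial) := by
  have hx : (x : ℚ) + m - m = x := by ring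
  rcases Nat.even_or_odd' n with ⟨h, rfl | rfl⟩
  · have := (coeffPoly_sub_natCast ((x : ℚ) + m) m h).1
    rw [hx] at this
    simpa [show ¬ Odd (2 * h) by simp] using this
  · have := (coeffPoly_sub_natCast ((x : ℚ) + m) m h).2
    rw [hx] at this
    simpa [show (2 * h + 1) / 2 = h by omega] using this

lemma coeffPoly_eq_of_le (x m n : ℕ) (hmn : m ≤ n) :
    coeffPoly (x : ℚ) ((x : ℚ) + m) n = (n.factorial : ℚ) / ((n / 2).factorial : ℚ) *
      rising ((x : ℚ) + m) (n / 2 - m / 2) *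
      ∑ k ∈ Finset.range (m / 2 + 1),
        (m.choose (2 * k + if Odd n then 1 else 0) : ℚ) *
          rising ((n / 2 : ℕ) - (k : ℚ) + 1) k *
          rising ((x : ℚ) + ((m + 1) / 2 : ℕ) + (n / 2 : ℕ)) (m / 2 - k) := by
  have hle : m / 2 ≤ n / 2 := Nat.div_le_div_right hmn
  rw [coeffPoly_natCast_add, ← Finset.sum_subset
    (Finset.range_subset_range.2 (Nat.succ_le_succ hle)), div_mul_eq_mul_div, div_mul_eq_mul_div,
    mul_assoc, mul_div_assoc, Finset.mul_sum _ _ (rising _ _), Finset.sum_div]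
  · congr 1
    refine Finset.sum_congr rfl fun k hk => ?_
    have hk : k ≤ m / 2 := Nat.lt_succ_iff.1 (Finset.mem_range.1 hk)
    have h1 := rising_add ((x : ℚ) + m) (n / 2 - m / 2) (m / 2 - k)
    rw [show n / 2 - m / 2 + (m / 2 - k) = n / 2 - k by omega, Nat.cast_sub hle,
      show (x : ℚ) + m + (((n / 2 : ℕ) : ℚ) - ((m / 2 : ℕ) : ℚ)) =
        x + ((m + 1) / 2 : ℕ) + (n / 2 : ℕ) by
        have : (m : ℚ) = ((m / 2 : ℕ) : ℚ) + ((m + 1) / 2 : ℕ) := by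
          exact_mod_cast (by omega : m = m / 2 + (m + 1) / 2)
        rw [this]
        ring_nf] at h1
    have h2 := cast_factorial_add (n / 2 - k) k
    rw [Nat.sub_add_cancel (hk.trans hle), Nat.cast_sub (hk.trans hle)] at h2
    have h3 := Nat.cast_ne_zero (R := ℚ) |>.2 (n / 2 - k).factorial_ne_zero
    have h4 := Nat.cast_ne_zero (R := ℚ) |>.2 (n / 2).factorial_ne_zero
    rw [h1]
    field_simp
    rw [h2]
    ring
  · intro k _ hk
    rw [Finset.mem_range, not_lt] at hk
    rw [Nat.choose_eq_zero_of_lt (by omega)]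
    simp

lemma poch_eq_rising (a : ℚ) (k : ℕ) : poch a k = rising a k := rfl

end Specialization

/-- Theorem 9: the case `y = x + m`. -/
theorem thm9 (x m n : ℕ) (hmn : m ≤ n) (h : 1 ≤ x + m) :
    Edet x (x + m) n =
      ((Nat.factorial n : ℚ) / (Nat.factorial (n / 2) : ℚ)) *
      (∏ i ∈ Finset.range n,
        ((Nat.factorial i : ℚ) * (Nat.factorial (2 * x + m + i - 1) : ℚ) *
            poch (3 * x + m + 2 * i + 1 : ℚ) i * poch (3 * x + 2 * m + 2 * i + 1 : ℚ) i /
          ((Nat.factorial (x + 2 * i + 1) : ℚ) * (Nat.factorial (x + m + 2 * i + 1) : ℚ)))) *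
      poch (x + m : ℚ) (n / 2 - m / 2) *
      (∑ k ∈ Finset.range (m / 2 + 1),
        (m.choose (2 * k + if Odd n then 1 else 0) : ℚ) *
          poch ((n / 2 : ℕ) - (k : ℚ) + 1) k *
          poch ((x : ℚ) + ((m + 1) / 2 : ℕ) + (n / 2 : ℕ)) (m / 2 - k)) := by
  rw [Edet_eq_det_polyMatrix x (x + m) n (by omega), det_polyMatrix, Nat.cast_add,
    coeffPoly_eq_of_le x m n hmn]
  simp only [poch_eq_rising]
  have hprod : (∏ i ∈ Finset.range n, (((x + (x + m) + i - 1).factorial : ℚ) /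
      ((x + 2 * i + 1).factorial * (x + m + 2 * i + 1).factorial))) *
        linearFactors (x : ℚ) (x + m) n =
      ∏ i ∈ Finset.range n,
        ((Nat.factorial i : ℚ) * (Nat.factorial (2 * x + m + i - 1) : ℚ) *
            rising (3 * x + m + 2 * i + 1 : ℚ) i * rising (3 * x + 2 * m + 2 * i + 1 : ℚ) i /
          ((Nat.factorial (x + 2 * i + 1) : ℚ) * (Nat.factorial (x + m + 2 * i + 1) : ℚ))) := by
    rw [linearFactors, ← Finset.prod_mul_distrib]
    refine Finset.prod_congr rfl fun i _ => ?_
    rw [show x + (x + m) + i - 1 = 2 * x + m + i - 1 by omega,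
      show 2 * (x : ℚ) + (x + m) = 3 * x + m by ring,
      show (x : ℚ) + 2 * (x + m) = 3 * x + 2 * m by ring]
    ring
  rw [← hprod]
  ring
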